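/- arXiv:1803.00627 — 2 statements merged into one kernel-verified Lean document; each statement's English description precedes it below -/
import Mathlib

section
/- Let n = Σ_{i=1}^r s_{n_i} M_{n_i}, where n_1 > n_2 > … > n_r ≥ 0 and 1 ≤ s_{n_i} ≤ m_{n_i}−1 for all 1 ≤ i ≤ r, and set n^{(k)} = n − Σ_{i=1}^k s_{n_i} M_{n_i} for 0 < k ≤ r. Then, pointwise on G_m, n·K_n = Σ_{k=1}^r (∏_{j=1}^{k−1} r_{n_j}^{s_{n_j}}) · s_{n_k} M_{n_k} K_{s_{n_k} M_{n_k}} + Σ_{k=1}^{r−1} (∏_{j=1}^{k−1} r_{n_j}^{s_{n_j}}) · n^{(k)} D_{s_{n_k} M_{n_k}} (empty products are interpreted as 1). -/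
open MeasureTheory Complex Finset
open scoped BigOperators ENNReal NNReal

noncomputable section

instance (n : ℕ) : MeasurableSpace (ZMod n) := ⊤

/-- The Vilenkin group determined by the generating sequence `m`. -/
abbrev Gm (m : ℕ → ℕ) : Type := ∀ _k : ℕ, ZMod (m _k)

namespace Vilenkin

variable (m : ℕ → ℕ)

/-- The generalized powers `M_0 = 1`, `M_{k+1} = m_k · M_k`. -/
def M : ℕ → ℕ
  | 0 => 1
  | k + 1 => m k * M k

/-- The `j`-th digit `n_j` of `n` in the generalized number system based on `m`. -/
def digit (n j : ℕ) : ℕ := n / M m j % m j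

/-- `|n|`, the index of the highest nonzero digit of `n`. -/
def hi (n : ℕ) : ℕ := Nat.findGreatest (fun j => digit m n j ≠ 0) n

/-- `⟨n⟩`, the index of the lowest nonzero digit of `n`. -/
def lo (n : ℕ) : ℕ := sInf {j | digit m n j ≠ 0}

/-- The generalized Rademacher functions `r_k(x) = exp(2πi x_k / m_k)`. -/
def rad (k : ℕ) (x : Gm m) : ℂ :=
  Complex.exp (2 * Real.pi * Complex.I * ((x k).val : ℂ) / (m k : ℂ))

/-- The Vilenkin functions `ψ_n = ∏_k r_k^{n_k}`. -/
def vil (n : ℕ) (x : Gm m) : ℂ :=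
  ∏ k ∈ Finset.range (n + 1), rad m k x ^ digit m n k

/-- The Dirichlet kernels `D_n = ∑_{k=0}^{n-1} ψ_k`. -/
def D (n : ℕ) (x : Gm m) : ℂ := ∑ k ∈ Finset.range n, vil m k x

/-- The Fejér kernels `K_n = (1/n) ∑_{k=1}^{n} D_k`. -/
def K (n : ℕ) (x : Gm m) : ℂ := (n : ℂ)⁻¹ * ∑ k ∈ Finset.range n, D m (k + 1) x

/-- The Nörlund kernels `F_n = (1/Q_n) ∑_{k=1}^{n} q_{n-k} D_k` where
`Q_n = ∑_{k=0}^{n-1} q_k`. -/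
def FK (q : ℕ → ℝ) (n : ℕ) (x : Gm m) : ℂ :=
  ((∑ k ∈ Finset.range n, q k : ℝ) : ℂ)⁻¹ *
    ∑ k ∈ Finset.range n, (q (n - (k + 1)) : ℂ) * D m (k + 1) x

/-- The cylinder subgroup `I_n = {x : x_0 = … = x_{n-1} = 0}`. -/
def I (n : ℕ) : Set (Gm m) := {x | ∀ k < n, x k = 0}

/-- The cylinder of length `n` around `x`. -/
def cylAt (n : ℕ) (x : Gm m) : Set (Gm m) := {y | ∀ k < n, y k = x k}

/-- `μ` is the normalized Haar measure of `G_m`: the (unique) Borel probability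
measure giving each cylinder of length `n` measure `1 / M_n`. -/
def IsHaar (μ : Measure (Gm m)) : Prop :=
  ∀ (n : ℕ) (x : Gm m), μ (cylAt m n x) = (M m n : ℝ≥0∞)⁻¹

/-- A martingale with respect to the filtration `(ℱ_n)` on `G_m`, where `ℱ_n` is
generated by the first `n` coordinates: each `f n` is integrable and depends only
on the first `n` coordinates, and the conditional expectation of `f N` with
respect to `ℱ_n` (which under the Haar measure is given by averaging over the
cylinders of length `n`) equals `f n` for `n ≤ N`. -/
structure IsMartingale (μ : Measure (Gm m)) (f : ℕ → Gm m → ℂ) : Prop where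
  integrable : ∀ n, Integrable (f n) μ
  adapted : ∀ (n : ℕ) (x y : Gm m), (∀ k < n, x k = y k) → f n x = f n y
  mart : ∀ n N : ℕ, n ≤ N → ∀ x : Gm m,
    f n x = (M m n : ℂ) * ∫ t in cylAt m n x, f N t ∂μ

/-- The Vilenkin–Fourier coefficients of a martingale:
`f̂(i) = lim_k ∫ f^(k) conj(ψ_i) dμ`; for a martingale these integrals are
constant as soon as `M_k > i`, in particular from `k = i + 1` on. -/
def coeff (μ : Measure (Gm m)) (f : ℕ → Gm m → ℂ) (i : ℕ) : ℂ :=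
  ∫ x, f (i + 1) x * (starRingEnd ℂ) (vil m i x) ∂μ

/-- The partial sums `S_n f = ∑_{k=0}^{n-1} f̂(k) ψ_k`. -/
def S (μ : Measure (Gm m)) (f : ℕ → Gm m → ℂ) (n : ℕ) (x : Gm m) : ℂ :=
  ∑ k ∈ Finset.range n, coeff m μ f k * vil m k x

/-- The Fejér means `σ_n f = (1/n) ∑_{k=1}^{n} S_k f`. -/
def sigma (μ : Measure (Gm m)) (f : ℕ → Gm m → ℂ) (n : ℕ) (x : Gm m) : ℂ :=
  (n : ℂ)⁻¹ * ∑ k ∈ Finset.range n, S m μ f (k + 1) x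

/-- The Nörlund means `t_n f = (1/Q_n) ∑_{k=1}^{n} q_{n-k} S_k f`. -/
def T (μ : Measure (Gm m)) (q : ℕ → ℝ) (f : ℕ → Gm m → ℂ) (n : ℕ) (x : Gm m) : ℂ :=
  ((∑ k ∈ Finset.range n, q k : ℝ) : ℂ)⁻¹ *
    ∑ k ∈ Finset.range n, (q (n - (k + 1)) : ℂ) * S m μ f (k + 1) x

/-- The martingale maximal function `f* = sup_n |f^(n)|`. -/
def mstar (f : ℕ → Gm m → ℂ) (x : Gm m) : ℝ≥0∞ := ⨆ n, (‖f n x‖₊ : ℝ≥0∞)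

/-- The `L_p`-type quasi-norm `(∫ g^p dμ)^{1/p}` of an `ℝ≥0∞`-valued function. -/
def eLp (μ : Measure (Gm m)) (p : ℝ) (g : Gm m → ℝ≥0∞) : ℝ≥0∞ :=
  (∫⁻ x, g x ^ p ∂μ) ^ (1 / p)

/-- Membership in the martingale Hardy space `H_p`: `‖f‖_{H_p} = ‖f*‖_{L_p} < ∞`. -/
def MemHp (μ : Measure (Gm m)) (p : ℝ) (f : ℕ → Gm m → ℂ) : Prop :=
  eLp m μ p (mstar m f) ≠ ⊤

/-- The weak-`L_p` quasi-norm `sup_{t>0} t · μ(g > t)^{1/p}`. -/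
def wLp (μ : Measure (Gm m)) (p : ℝ) (g : Gm m → ℝ≥0∞) : ℝ≥0∞ :=
  ⨆ t : ℝ≥0, (t : ℝ≥0∞) * μ {x | (t : ℝ≥0∞) < g x} ^ (1 / p)

end Vilenkin

namespace Vilenkin

variable {m : ℕ → ℕ}

theorem M_pos (hm : ∀ k, 2 ≤ m k) (k : ℕ) : 0 < M m k := by
  induction k with
  | zero => simp [M]
  | succ k ih => exact Nat.mul_pos (by have := hm k; omega) ih

theorem M_dvd_M {j k : ℕ} (h : j ≤ k) : M m j ∣ M m k := by
  induction h with
  | refl => exact dvd_rfl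
  | step _ ih => exact ih.mul_left _

theorem M_le_M (hm : ∀ k, 2 ≤ m k) {j k : ℕ} (h : j ≤ k) : M m j ≤ M m k :=
  Nat.le_of_dvd (M_pos hm k) (M_dvd_M h)

theorem lt_M (hm : ∀ k, 2 ≤ m k) (k : ℕ) : k < M m k := by
  induction k with
  | zero => simp [M]
  | succ k ih =>
    have : 2 * M m k ≤ M m (k + 1) := Nat.mul_le_mul_right _ (hm k)
    omega

theorem digit_eq_zero (hm : ∀ k, 2 ≤ m k) {n N k : ℕ} (hn : n < M m N) (hk : N ≤ k) :
    digit m n k = 0 := by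
  simp [digit, Nat.div_eq_of_lt (hn.trans_le (M_le_M hm hk))]

theorem mul_M_add_lt (hm : ∀ k, 2 ≤ m k) {N s j k : ℕ} (hs : s < m N) (hj : j < M m N)
    (hk : N < k) : s * M m N + j < M m k := by
  calc s * M m N + j < (s + 1) * M m N := by rw [add_one_mul]; omega
    _ ≤ M m (N + 1) := Nat.mul_le_mul_right _ hs
    _ ≤ M m k := M_le_M hm hk

theorem digit_mul_M_add (hm : ∀ k, 2 ≤ m k) {N s j : ℕ} (hs : s < m N) (hj : j < M m N)
    (k : ℕ) : digit m (s * M m N + j) k = (if k = N then s else 0) + digit m j k := by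
  rcases lt_trichotomy k N with hk | rfl | hk
  · obtain ⟨c, hc⟩ : M m (k + 1) ∣ M m N := M_dvd_M hk
    have hsum : s * M m N + j = j + M m k * (m k * (s * c)) := by
      rw [hc, M]; ring
    simp [digit, hk.ne, hsum, Nat.add_mul_div_left _ _ (M_pos hm k)]
  · have hdiv : (s * M m k + j) / M m k = s := by
      rw [mul_comm, Nat.mul_add_div (M_pos hm k), Nat.div_eq_of_lt hj, add_zero]
    rw [digit_eq_zero hm hj le_rfl, digit, hdiv, Nat.mod_eq_of_lt hs, if_pos rfl, add_zero]
  · rw [digit_eq_zero hm (mul_M_add_lt hm hs hj hk) le_rfl, digit_eq_zero hm hj hk.le,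
      if_neg hk.ne']

theorem vil_eq_prod_range (hm : ∀ k, 2 ≤ m k) {n L : ℕ} (hL : n < L) (x : Gm m) :
    vil m n x = ∏ k ∈ range L, rad m k x ^ digit m n k := by
  refine prod_subset (range_mono hL) fun k _ hk => ?_
  rw [digit_eq_zero hm (lt_M hm n) (by simp at hk; omega), pow_zero]

theorem vil_mul_M_add (hm : ∀ k, 2 ≤ m k) {N s j : ℕ} (hs : s < m N) (hj : j < M m N)
    (x : Gm m) : vil m (s * M m N + j) x = rad m N x ^ s * vil m j x := by
  have hL : s * M m N + j < s * M m N + j + N + 1 := by omega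
  have hL' : j < s * M m N + j + N + 1 := by omega
  rw [vil_eq_prod_range hm hL, vil_eq_prod_range hm hL']
  simp_rw [digit_mul_M_add hm hs hj, pow_add, prod_mul_distrib]
  congr 1
  rw [prod_eq_single_of_mem N (by simp) fun k _ hk => by simp [hk], if_pos rfl]

theorem D_mul_M_add (hm : ∀ k, 2 ≤ m k) {N s j : ℕ} (hs : s < m N) (hj : j ≤ M m N)
    (x : Gm m) :
    D m (s * M m N + j) x = D m (s * M m N) x + rad m N x ^ s * D m j x := by
  rw [D, sum_range_add, D, D, mul_sum]
  congr 1
  exact sum_congr rfl fun k hk => vil_mul_M_add hm hs ((mem_range.1 hk).trans_le hj) x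

theorem natCast_mul_K (n : ℕ) (x : Gm m) :
    (n : ℂ) * K m n x = ∑ k ∈ range n, D m (k + 1) x := by
  rcases eq_or_ne n 0 with rfl | hn
  · simp
  · rw [K, mul_inv_cancel_left₀ (Nat.cast_ne_zero.2 hn)]

theorem natCast_mul_K_mul_M_add (hm : ∀ k, 2 ≤ m k) {N s j : ℕ} (hs : s < m N)
    (hj : j ≤ M m N) (x : Gm m) :
    ((s * M m N + j : ℕ) : ℂ) * K m (s * M m N + j) x =
      ((s * M m N : ℕ) : ℂ) * K m (s * M m N) x + j * D m (s * M m N) x +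
        rad m N x ^ s * (j * K m j x) := by
  have hD : ∀ k ∈ range j, D m (s * M m N + k + 1) x =
      D m (s * M m N) x + rad m N x ^ s * D m (k + 1) x := fun k hk =>
    D_mul_M_add hm hs ((Nat.succ_le_of_lt (mem_range.1 hk)).trans hj) x
  rw [natCast_mul_K, natCast_mul_K, natCast_mul_K, sum_range_add, sum_congr rfl hD,
    sum_add_distrib, sum_const, card_range, nsmul_eq_mul, mul_sum, add_assoc]

theorem sum_mul_M_lt (hm : ∀ k, 2 ≤ m k) (r : ℕ) (nn s : ℕ → ℕ)
    (hdec : ∀ i j, i < j → j < r → nn j < nn i) (hs : ∀ i < r, s i < m (nn i))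
    {N : ℕ} (hN : ∀ i < r, nn i < N) : ∑ i ∈ range r, s i * M m (nn i) < M m N := by
  induction r generalizing nn s N with
  | zero => simpa using M_pos hm N
  | succ r ih =>
    rw [sum_range_succ', add_comm]
    refine mul_M_add_lt hm (hs 0 (by omega)) ?_ (hN 0 (by omega))
    exact ih (fun i => nn (i + 1)) (fun i => s (i + 1))
      (fun i j hij hj => hdec _ _ (by omega) (by omega)) (fun i hi => hs _ (by omega))
      (fun i hi => hdec _ _ (by omega) (by omega))

theorem natCast_mul_K_sum_mul_M (hm : ∀ k, 2 ≤ m k) (r : ℕ) (nn s : ℕ → ℕ)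
    (hdec : ∀ i j, i < j → j < r → nn j < nn i) (hs : ∀ i < r, s i < m (nn i)) (x : Gm m) :
    ((∑ i ∈ range r, s i * M m (nn i) : ℕ) : ℂ) * K m (∑ i ∈ range r, s i * M m (nn i)) x =
      (∑ k ∈ range r, (∏ j ∈ range k, rad m (nn j) x ^ s j) *
        ((s k * M m (nn k) : ℕ) : ℂ) * K m (s k * M m (nn k)) x) +
      ∑ k ∈ range r, (∏ j ∈ range k, rad m (nn j) x ^ s j) *
        ((∑ i ∈ Ico (k + 1) r, s i * M m (nn i) : ℕ) : ℂ) * D m (s k * M m (nn k)) x := by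
  induction r generalizing nn s with
  | zero => simp
  | succ r ih =>
    have hdec' : ∀ i j, i < j → j < r → nn (j + 1) < nn (i + 1) :=
      fun i j hij hj => hdec _ _ (by omega) (by omega)
    have hs' : ∀ i < r, s (i + 1) < m (nn (i + 1)) := fun i hi => hs _ (by omega)
    have hlt := sum_mul_M_lt hm r (fun i => nn (i + 1)) (fun i => s (i + 1)) hdec' hs'
      (N := nn 0) fun i hi => hdec _ _ (by omega) (by omega)
    have htail : ∀ k, ∑ i ∈ Ico (k + 1) (r + 1), s i * M m (nn i) =
        ∑ i ∈ Ico k r, s (i + 1) * M m (nn (i + 1)) := fun k =>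
      (sum_Ico_add' (fun i => s i * M m (nn i)) k r 1).symm
    have hprod : ∀ k, ∏ j ∈ range (k + 1), rad m (nn j) x ^ s j =
        rad m (nn 0) x ^ s 0 * ∏ j ∈ range k, rad m (nn (j + 1)) x ^ s (j + 1) := fun k => by
      rw [prod_range_succ', mul_comm]
    rw [sum_range_succ', add_comm, natCast_mul_K_mul_M_add hm (hs 0 (by omega)) hlt.le,
      ih (fun i => nn (i + 1)) (fun i => s (i + 1)) hdec' hs', sum_range_succ' _ r,
      sum_range_succ' _ r]
    simp only [htail, hprod, range_zero, prod_empty, one_mul, mul_add, mul_sum, mul_assoc,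
      ← range_eq_Ico]
    ring

end Vilenkin

/-- the decomposition of `n K_n` from Lemma 5 (Blahota–Tephnadze),
for `n = ∑_{i=1}^r s_{n_i} M_{n_i}` with `n_1 > … > n_r ≥ 0` and
`1 ≤ s_{n_i} ≤ m_{n_i} - 1`, where `n^{(k)} = n - ∑_{i=1}^k s_{n_i} M_{n_i}`
(equivalently, the tail sum `∑_{i=k+1}^{r} s_{n_i} M_{n_i}`). -/
theorem statement1 (m : ℕ → ℕ) (hm : ∀ k, 2 ≤ m k)
    (r : ℕ) (hr : 0 < r) (nn s : ℕ → ℕ)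
    (hdec : ∀ i j, i < j → j < r → nn j < nn i)
    (hs : ∀ i < r, 1 ≤ s i ∧ s i ≤ m (nn i) - 1)
    (n : ℕ) (hn : n = ∑ i ∈ Finset.range r, s i * Vilenkin.M m (nn i))
    (x : Gm m) :
    (n : ℂ) * Vilenkin.K m n x =
      (∑ k ∈ Finset.range r,
        (∏ j ∈ Finset.range k, Vilenkin.rad m (nn j) x ^ s j) *
          ((s k * Vilenkin.M m (nn k) : ℕ) : ℂ) *
          Vilenkin.K m (s k * Vilenkin.M m (nn k)) x) +
      ∑ k ∈ Finset.range (r - 1),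
        (∏ j ∈ Finset.range k, Vilenkin.rad m (nn j) x ^ s j) *
          ((∑ i ∈ Finset.Ico (k + 1) r, s i * Vilenkin.M m (nn i) : ℕ) : ℂ) *
          Vilenkin.D m (s k * Vilenkin.M m (nn k)) x := by
  obtain ⟨r, rfl⟩ : ∃ r', r = r' + 1 := ⟨r - 1, by omega⟩
  rw [hn, Vilenkin.natCast_mul_K_sum_mul_M hm (r + 1) nn s hdec fun i hi => by
    have := hs i hi
    have := hm (nn i)
    omega]
  congr 1
  rw [sum_range_succ _ r]
  simp
end
end

section
/- Let 0 < p < 1. There exists a constant c_p > 0, depending only on p and λ = sup_k m_k, such that for every martingale f ∈ H_p and every n ≥ 1, |f̂(n)| ≤ c_p · n^{1/p−1} · ‖f‖_{H_p}. -/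
open MeasureTheory Complex Finset
open scoped BigOperators ENNReal NNReal

noncomputable section

namespace Vilenkin

/-- The points whose first `K` coordinates are given by `c` and whose others vanish. -/
def extendByZero (m : ℕ → ℕ) (K : ℕ) (c : ∀ k : Fin K, ZMod (m k)) : Gm m :=
  fun k => if h : k < K then c ⟨k, h⟩ else 0

theorem mem_cylAt_extendByZero (m : ℕ → ℕ) (K : ℕ) (c : ∀ k : Fin K, ZMod (m k)) (y : Gm m) :
    y ∈ cylAt m K (extendByZero m K c) ↔ (fun k : Fin K => y k) = c := by
  constructor
  · intro h
    funext k
    have := h k k.2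
    simpa [extendByZero] using this
  · rintro rfl k hk
    simp [extendByZero, hk]

theorem measurableSet_cylAt (m : ℕ → ℕ) (K : ℕ) (x : Gm m) : MeasurableSet (cylAt m K x) := by
  have h : cylAt m K x = ⋂ k : ℕ, ⋂ _ : k < K, (fun y : Gm m => y k) ⁻¹' {x k} := by
    ext y; simp [cylAt]
  rw [h]
  exact MeasurableSet.iInter fun k => MeasurableSet.iInter fun _ =>
    measurable_pi_apply k MeasurableSpace.measurableSet_top

theorem pairwise_disjoint_cylAt (m : ℕ → ℕ) (K : ℕ) :
    Pairwise (Function.onFun Disjoint fun c => cylAt m K (extendByZero m K c)) := by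
  intro c d hcd
  refine Set.disjoint_left.2 fun y hy hy' => hcd ?_
  rw [mem_cylAt_extendByZero] at hy hy'
  exact hy.symm.trans hy'

theorem iUnion_cylAt (m : ℕ → ℕ) (K : ℕ) :
    ⋃ c, cylAt m K (extendByZero m K c) = Set.univ :=
  Set.eq_univ_of_forall fun y =>
    Set.mem_iUnion.2 ⟨fun k : Fin K => y k, (mem_cylAt_extendByZero m K _ y).2 rfl⟩

theorem two_pow_le_M {m : ℕ → ℕ} (hm : ∀ k, 2 ≤ m k) (n : ℕ) : 2 ^ n ≤ M m n := by
  induction n with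
  | zero => simp [M]
  | succ n ih =>
    rw [pow_succ, mul_comm, M]
    exact Nat.mul_le_mul (hm n) ih

theorem M_mono {m : ℕ → ℕ} (hm : ∀ k, 2 ≤ m k) : Monotone (M m) :=
  monotone_nat_of_le_succ fun n => Nat.le_mul_of_pos_left _ (by have := hm n; omega)

theorem norm_rad (m : ℕ → ℕ) (k : ℕ) (x : Gm m) : ‖rad m k x‖ = 1 := by
  have h : 2 * (Real.pi : ℂ) * Complex.I * ((x k).val : ℂ) / (m k : ℂ) =
      ((2 * Real.pi * (x k).val / m k : ℝ) : ℂ) * Complex.I := by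
    push_cast; ring
  rw [rad, h, Complex.norm_exp_ofReal_mul_I]

theorem norm_vil (m : ℕ → ℕ) (n : ℕ) (x : Gm m) : ‖vil m n x‖ = 1 := by
  simp [vil, norm_prod, norm_rad]

theorem vil_congr {m : ℕ → ℕ} (hm : ∀ k, 2 ≤ m k) {n K : ℕ} (hn : n < M m K) {x y : Gm m}
    (hxy : ∀ k < K, x k = y k) : vil m n x = vil m n y := by
  refine Finset.prod_congr rfl fun k _ => ?_
  rcases lt_or_ge k K with hk | hk
  · simp [rad, hxy k hk]
  · simp [digit, Nat.div_eq_of_lt (hn.trans_le (M_mono hm hk))]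

/-- Every positive integer lies between two consecutive generalized powers. -/
theorem exists_lt_M_le_mul {m : ℕ → ℕ} {lam : ℕ} (hm : ∀ k, 2 ≤ m k) (hl : ∀ k, m k ≤ lam)
    {n : ℕ} (hn : 1 ≤ n) : ∃ K ≤ n + 1, n < M m K ∧ M m K ≤ lam * n := by
  classical
  have hex : ∃ K, n < M m K := ⟨n, Nat.lt_two_pow_self.trans_le (two_pow_le_M hm n)⟩
  have hle : Nat.find hex ≤ n :=
    Nat.find_min' hex (Nat.lt_two_pow_self.trans_le (two_pow_le_M hm n))
  have hspec := Nat.find_spec hex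
  refine ⟨Nat.find hex, by omega, hspec, ?_⟩
  rcases hK : Nat.find hex with _ | N
  · rw [hK, M] at hspec
    omega
  · have hN : M m N ≤ n := not_lt.1 (Nat.find_min hex (by omega))
    exact Nat.mul_le_mul (hl N) hN

/-- A Vilenkin–Fourier coefficient of index below `M_K` is bounded by the `L_1`-norm of `f^(K)`,
written as a sum over cylinders of length `K`. -/
theorem enorm_coeff_le {m : ℕ → ℕ} (hm : ∀ k, 2 ≤ m k) [∀ k, NeZero (m k)]
    {μ : Measure (Gm m)} {f : ℕ → Gm m → ℂ} (hf : IsMartingale m μ f) {n K : ℕ}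
    (hK : K ≤ n + 1) (hn : n < M m K) :
    ‖coeff m μ f n‖ₑ ≤
      ∑ c : ∀ k : Fin K, ZMod (m k), ‖f K (extendByZero m K c)‖ₑ * (M m K : ℝ≥0∞)⁻¹ := by
  by_cases hint : Integrable (fun x => f (n + 1) x * (starRingEnd ℂ) (vil m n x)) μ
  swap
  · simp [coeff, integral_undef hint]
  have hM : M m K ≠ 0 := by omega
  rw [coeff, ← setIntegral_univ, ← iUnion_cylAt m K, integral_iUnion_fintype
    (fun c => measurableSet_cylAt m K _) (pairwise_disjoint_cylAt m K)
    (fun c => hint.integrableOn)]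
  refine (enorm_sum_le _ _).trans (Finset.sum_le_sum fun c _ => ?_)
  rw [setIntegral_congr_fun (measurableSet_cylAt m K _)
    (g := fun x => f (n + 1) x * (starRingEnd ℂ) (vil m n (extendByZero m K c)))
    (fun x hx => by simp only; rw [vil_congr hm hn hx]), integral_mul_const, enorm_mul,
    hf.mart K (n + 1) hK, enorm_mul]
  have h1 : ‖(starRingEnd ℂ) (vil m n (extendByZero m K c))‖ₑ = 1 := by
    rw [← ofReal_norm, RCLike.norm_conj, norm_vil, ENNReal.ofReal_one]
  have h2 : ‖(M m K : ℂ)‖ₑ = M m K := by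
    rw [← ofReal_norm, Complex.norm_natCast, ENNReal.ofReal_natCast]
  rw [h1, h2, mul_one, mul_right_comm, ENNReal.mul_inv_cancel (by simpa using hM) (by simp),
    one_mul]

/-- The `p`-th moment of `f^(K)`, written as a sum over cylinders of length `K`, is at most that of
the maximal function. -/
theorem sum_rpow_le_lintegral_mstar {m : ℕ → ℕ} [∀ k, NeZero (m k)] {μ : Measure (Gm m)}
    (hμ : IsHaar m μ) {f : ℕ → Gm m → ℂ} (hf : IsMartingale m μ f) (K : ℕ) {p : ℝ} (hp : 0 ≤ p) :
    ∑ c : ∀ k : Fin K, ZMod (m k), ‖f K (extendByZero m K c)‖ₑ ^ p * (M m K : ℝ≥0∞)⁻¹ ≤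
      ∫⁻ x, mstar m f x ^ p ∂μ := by
  rw [← setLIntegral_univ (fun x => mstar m f x ^ p), ← iUnion_cylAt m K,
    lintegral_iUnion (fun c => measurableSet_cylAt m K _) (pairwise_disjoint_cylAt m K),
    tsum_fintype]
  refine Finset.sum_le_sum fun c _ => ?_
  rw [← hμ K (extendByZero m K c), ← setLIntegral_const]
  refine setLIntegral_mono' (measurableSet_cylAt m K _) fun x hx => ?_
  refine ENNReal.rpow_le_rpow ?_ hp
  rw [← hf.adapted K x _ hx]
  exact le_iSup (fun n => (‖f n x‖₊ : ℝ≥0∞)) K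

/-- A weighted `ℓ^p` bound controls the `ℓ^1` sum when `p ≤ 1` and all weights are equal. -/
theorem sum_mul_inv_le_of_sum_rpow_mul_inv_le {ι : Type*} (s : Finset ι) (F : ι → ℝ≥0∞)
    {N A : ℝ≥0∞} (hN0 : N ≠ 0) (hN : N ≠ ⊤) {p : ℝ} (hp0 : 0 < p) (hp1 : p ≤ 1)
    (h : ∑ c ∈ s, F c ^ p * N⁻¹ ≤ A) :
    ∑ c ∈ s, F c * N⁻¹ ≤ N ^ (1 / p - 1) * A ^ (1 / p) := by
  have hq : 0 ≤ 1 / p - 1 := by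
    rw [sub_nonneg, le_div_iff₀ hp0]; linarith
  have hF : ∀ c ∈ s, F c * N⁻¹ ≤ (N * A) ^ (1 / p - 1) * (F c ^ p * N⁻¹) := by
    intro c hc
    have hc' : F c ^ p ≤ N * A := by
      have := (Finset.single_le_sum (f := fun c => F c ^ p * N⁻¹) (fun _ _ => zero_le) hc).trans h
      rwa [← div_eq_mul_inv, ENNReal.div_le_iff hN0 hN, mul_comm] at this
    have hsplit : F c = (F c ^ p) ^ (1 / p - 1) * F c ^ p := by
      rw [← ENNReal.rpow_mul, ← ENNReal.rpow_add_of_nonneg _ _ (by positivity) hp0.le]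
      have : p * (1 / p - 1) + p = 1 := by field_simp; ring
      rw [this, ENNReal.rpow_one]
    rw [← mul_assoc]
    gcongr
    calc F c = (F c ^ p) ^ (1 / p - 1) * F c ^ p := hsplit
      _ ≤ _ := by gcongr
  calc ∑ c ∈ s, F c * N⁻¹ ≤ ∑ c ∈ s, (N * A) ^ (1 / p - 1) * (F c ^ p * N⁻¹) :=
        Finset.sum_le_sum hF
    _ = (N * A) ^ (1 / p - 1) * ∑ c ∈ s, F c ^ p * N⁻¹ := by rw [Finset.mul_sum]
    _ ≤ (N * A) ^ (1 / p - 1) * A := by gcongr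
    _ = N ^ (1 / p - 1) * (A ^ (1 / p - 1) * A ^ (1 : ℝ)) := by
        rw [ENNReal.mul_rpow_of_nonneg _ _ hq, ENNReal.rpow_one, mul_assoc]
    _ = N ^ (1 / p - 1) * A ^ (1 / p) := by
        rw [← ENNReal.rpow_add_of_nonneg _ _ hq zero_le_one, sub_add_cancel]

end Vilenkin

/-- for `0 < p < 1` there is `c_p > 0` (depending only on `p` and
`λ = sup m_k`) with `|f̂(n)| ≤ c_p n^{1/p-1} ‖f‖_{H_p}` for every martingale
`f ∈ H_p` and every `n ≥ 1`. -/
theorem statement6 (p : ℝ) (hp0 : 0 < p) (hp1 : p < 1) (lam : ℕ) :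
    ∃ c : ℝ, 0 < c ∧
      ∀ (m : ℕ → ℕ), (∀ k, 2 ≤ m k) → (∀ k, m k ≤ lam) →
      ∀ (μ : Measure (Gm m)), Vilenkin.IsHaar m μ →
      ∀ (f : ℕ → Gm m → ℂ), Vilenkin.IsMartingale m μ f → Vilenkin.MemHp m μ p f →
      ∀ (n : ℕ), 1 ≤ n →
        (‖Vilenkin.coeff m μ f n‖₊ : ℝ≥0∞) ≤
          ENNReal.ofReal c * (n : ℝ≥0∞) ^ (1 / p - 1) *
            Vilenkin.eLp m μ p (Vilenkin.mstar m f) := by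
  have hq : 0 ≤ 1 / p - 1 := by
    rw [sub_nonneg, le_div_iff₀ hp0]; linarith
  refine ⟨((lam : ℝ) + 1) ^ (1 / p - 1), by positivity, ?_⟩
  intro m hm hl μ hμ f hf _ n hn
  have : ∀ k, NeZero (m k) := fun k => ⟨by have := hm k; omega⟩
  obtain ⟨K, hK, hnK, hKn⟩ := Vilenkin.exists_lt_M_le_mul hm hl hn
  have hM : Vilenkin.M m K ≠ 0 := by omega
  calc (‖Vilenkin.coeff m μ f n‖₊ : ℝ≥0∞)
      ≤ (Vilenkin.M m K : ℝ≥0∞) ^ (1 / p - 1) * Vilenkin.eLp m μ p (Vilenkin.mstar m f) :=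
        (Vilenkin.enorm_coeff_le hm hf hK hnK).trans
          (Vilenkin.sum_mul_inv_le_of_sum_rpow_mul_inv_le _ _ (by simpa using hM) (by simp)
            hp0 hp1.le (Vilenkin.sum_rpow_le_lintegral_mstar hμ hf K hp0.le))
    _ ≤ _ := by
        gcongr
        rw [← ENNReal.ofReal_rpow_of_nonneg (by positivity) hq,
          ← ENNReal.mul_rpow_of_nonneg _ _ hq]
        gcongr
        have hlam : ENNReal.ofReal ((lam : ℝ) + 1) = ((lam + 1 : ℕ) : ℝ≥0∞) := by
          rw [← ENNReal.ofReal_natCast]; push_cast; rfl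
        rw [hlam]
        exact_mod_cast hKn.trans (Nat.mul_le_mul_right n (Nat.le_succ lam))
end
end
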